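/- For a topological space (X, τ) the following are equivalent: (a) every neighborhood filter N_τ(x), x ∈ X, is productively Fréchet; (b) for every topology ξ on X all of whose neighborhood filters are strongly Fréchet, every neighborhood filter of the supremum topology τ ∨ ξ (the coarsest topology finer than both τ and ξ) is Fréchet; (c) for every topology ξ on X all of whose neighborhood filters are strongly Fréchet, every neighborhood filter of τ ∨ ξ is strongly Fréchet. -/

import Mathlib

open Filter Set

variable {X : Type*}

/-- Two filters mesh if all their members intersect, i.e. the filter generated by
pairwise intersections (which is `F ⊓ G` in Mathlib's order) is proper. -/
def Mesh (F G : Filter X) : Prop := Filter.NeBot (F ⊓ G)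

/-- The `△` relation: `F △ H` iff whenever `H` meshes `F` there is a proper countably
based filter refining `F ∨ H` (i.e. `≤ F ⊓ H` in Mathlib's order). -/
def Triangle (F H : Filter X) : Prop :=
  Mesh H F → ∃ L : Filter X, L.NeBot ∧ L.IsCountablyGenerated ∧ L ≤ F ⊓ H

/-- Fréchet filters: `F △ A` for every subset `A`. -/
def Frechet (F : Filter X) : Prop := ∀ A : Set X, Triangle F (𝓟 A)

/-- Strongly Fréchet filters: `F △ H` for every proper countably based filter `H`. -/
def StronglyFrechet (F : Filter X) : Prop :=
  ∀ H : Filter X, H.NeBot → H.IsCountablyGenerated → Triangle F H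

/-- Productively Fréchet filters: `F △ G` for every strongly Fréchet filter `G`. -/
def ProductivelyFrechet (F : Filter X) : Prop :=
  ∀ G : Filter X, StronglyFrechet G → Triangle F G

theorem StronglyFrechet.frechet {F : Filter X} (hF : StronglyFrechet F) : Frechet F := by
  intro A hA
  exact hF (𝓟 A) (hA.mono inf_le_left) inferInstance hA

theorem stronglyFrechet_pure (x : X) : StronglyFrechet (pure x) := by
  intro H _ _ hm
  refine ⟨H ⊓ pure x, hm, inferInstance, ?_⟩
  rw [inf_comm]

theorem StronglyFrechet.inf_right {G H : Filter X} (hG : StronglyFrechet G)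
    (hH : H.IsCountablyGenerated) : StronglyFrechet (G ⊓ H) := by
  intro K _ _ hm
  have e : K ⊓ (G ⊓ H) = (H ⊓ K) ⊓ G := by ac_rfl
  unfold Mesh at hm
  rw [e] at hm
  obtain ⟨L, hL, hLc, hle⟩ := hG (H ⊓ K) (hm.mono inf_le_left) inferInstance hm
  exact ⟨L, hL, hLc, hle.trans_eq (by ac_rfl)⟩

theorem StronglyFrechet.sup {F G : Filter X} (hF : StronglyFrechet F)
    (hG : StronglyFrechet G) : StronglyFrechet (F ⊔ G) := by
  intro H hH hHc hm
  unfold Mesh at hm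
  rw [inf_sup_left, sup_neBot] at hm
  obtain hm | hm := hm
  · obtain ⟨L, hL, hLc, hle⟩ := hF H hH hHc hm
    exact ⟨L, hL, hLc, hle.trans (inf_le_inf_right _ le_sup_left)⟩
  · obtain ⟨L, hL, hLc, hle⟩ := hG H hH hHc hm
    exact ⟨L, hL, hLc, hle.trans (inf_le_inf_right _ le_sup_right)⟩

theorem ProductivelyFrechet.stronglyFrechet_inf {F G : Filter X} (hF : ProductivelyFrechet F)
    (hG : StronglyFrechet G) : StronglyFrechet (F ⊓ G) := by
  intro H _ hHc hm
  have e : H ⊓ (F ⊓ G) = (G ⊓ H) ⊓ F := by ac_rfl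
  unfold Mesh at hm
  rw [e] at hm
  obtain ⟨L, hL, hLc, hle⟩ := hF (G ⊓ H) (hG.inf_right hHc) hm
  exact ⟨L, hL, hLc, hle.trans_eq (by ac_rfl)⟩

theorem stronglyFrechet_nhds_nhdsAdjoint {G : Filter X} (hG : StronglyFrechet G) (x y : X) :
    StronglyFrechet (@nhds X (nhdsAdjoint x G) y) := by
  obtain rfl | hne := eq_or_ne y x
  · rw [nhds_nhdsAdjoint_same]
    exact (stronglyFrechet_pure y).sup hG
  · rw [nhds_nhdsAdjoint_of_ne G hne]
    exact stronglyFrechet_pure y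

/-- If adjoining the point `x` to a proper filter `F` gives a Fréchet filter, then `F` has a proper
countably based refinement. -/
theorem exists_le_of_frechet_pure_sup {F : Filter X} {x : X} (hF : F.NeBot)
    (h : Frechet (pure x ⊔ F)) : ∃ L : Filter X, L.NeBot ∧ L.IsCountablyGenerated ∧ L ≤ F := by
  by_cases hx : (𝓟 {x}ᶜ ⊓ F).NeBot
  · obtain ⟨L, hL, hLc, hle⟩ := h {x}ᶜ (hx.mono (inf_le_inf_left _ le_sup_right))
    refine ⟨L, hL, hLc, hle.trans ?_⟩
    rw [inf_sup_right, ← principal_singleton, inf_principal]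
    simp
  · have hle : F ≤ pure x := by
      rw [not_neBot, inf_comm, inf_principal_eq_bot, compl_compl] at hx
      exact le_pure_iff.2 hx
    exact ⟨F, hF, by rw [hF.le_pure_iff.1 hle]; infer_instance, le_rfl⟩

/-- In Mathlib's order on topologies (`⊥` = discrete), `τ ⊓ ξ` is the coarsest topology
finer than both `τ` and `ξ`, i.e. the supremum topology `τ ∨ ξ` of the paper. -/
theorem stmt6 (τ : TopologicalSpace X) :
    List.TFAE [
      -- (a) every τ-neighborhood filter is productively Fréchet
      ∀ x : X, ProductivelyFrechet (@nhds X τ x),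
      -- (b) for every strongly Fréchet topology ξ, every (τ ∨ ξ)-neighborhood filter is Fréchet
      ∀ ξ : TopologicalSpace X, (∀ x : X, StronglyFrechet (@nhds X ξ x)) →
        ∀ x : X, Frechet (@nhds X (τ ⊓ ξ) x),
      -- (c) for every strongly Fréchet topology ξ, every (τ ∨ ξ)-neighborhood filter is
      -- strongly Fréchet
      ∀ ξ : TopologicalSpace X, (∀ x : X, StronglyFrechet (@nhds X ξ x)) →
        ∀ x : X, StronglyFrechet (@nhds X (τ ⊓ ξ) x)] := by
  tfae_have 1 → 3 := by
    intro h ξ hξ x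
    rw [@nhds_inf X τ ξ x]
    exact (h x).stronglyFrechet_inf (hξ x)
  tfae_have 3 → 2 := fun h ξ hξ x => (h ξ hξ x).frechet
  tfae_have 2 → 1 := by
    intro h x G hG hm
    have hx := h (nhdsAdjoint x G) (stronglyFrechet_nhds_nhdsAdjoint hG x) x
    rw [@nhds_inf X τ (nhdsAdjoint x G) x, nhds_nhdsAdjoint_same, inf_sup_left,
      inf_eq_right.2 (@pure_le_nhds X τ x)] at hx
    unfold Mesh at hm
    rw [inf_comm] at hm
    exact exists_le_of_frechet_pure_sup hm hx
  tfae_finish
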